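/- arXiv:2011.08473 — 5 statements merged into one kernel-verified Lean document; each statement's English description precedes it below -/
import Mathlib

section
/- Let S be a nonempty set and let f : S → ℝ, g : S → ℝ satisfy f(x) ≥ 0 and g(x) > 0 for all x ∈ S. For x₀ ∈ S, the following are equivalent: (i) x₀ maximizes the ratio x ↦ f(x)/g(x) over S (i.e., f(x)/g(x) ≤ f(x₀)/g(x₀) for all x ∈ S); (ii) the pair (x₀, y₀) with y₀ = √(f(x₀))/g(x₀) maximizes the function (x, y) ↦ 2·y·√(f(x)) − y²·g(x) over S × ℝ. Moreover, in either case the two optimal values coincide: 2·y₀·√(f(x₀)) − y₀²·g(x₀) = f(x₀)/g(x₀). -/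
/-- The quadratic transform attains the ratio at `y = √a / b`. -/
theorem quadratic_transform_eq {a b : ℝ} (ha : 0 ≤ a) (hb : 0 < b) :
    2 * (Real.sqrt a / b) * Real.sqrt a - (Real.sqrt a / b) ^ 2 * b = a / b := by
  have hb' := hb.ne'
  have hs := Real.sq_sqrt ha
  field_simp
  linarith

/-- The quadratic transform is bounded above by the ratio. -/
theorem quadratic_transform_le {a b : ℝ} (ha : 0 ≤ a) (hb : 0 < b) (y : ℝ) :
    2 * y * Real.sqrt a - y ^ 2 * b ≤ a / b := by
  rw [le_div_iff₀ hb]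
  nlinarith [sq_nonneg (y * b - Real.sqrt a), Real.sq_sqrt ha]

/-- Benson's transform (Lemma 1): the fractional program `max f(x)/g(x)` is
equivalent to the program `max_{x,y} 2y√(f(x)) − y²g(x)`, and the optimal
values coincide. -/
theorem benson_transform {S : Type*} [Nonempty S] (f g : S → ℝ)
    (hf : ∀ x, 0 ≤ f x) (hg : ∀ x, 0 < g x) (x₀ : S) :
    ((∀ x, f x / g x ≤ f x₀ / g x₀) ↔
      (∀ (x : S) (y : ℝ),
        2 * y * Real.sqrt (f x) - y ^ 2 * g x ≤
          2 * (Real.sqrt (f x₀) / g x₀) * Real.sqrt (f x₀) -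
            (Real.sqrt (f x₀) / g x₀) ^ 2 * g x₀)) ∧
    (2 * (Real.sqrt (f x₀) / g x₀) * Real.sqrt (f x₀) -
        (Real.sqrt (f x₀) / g x₀) ^ 2 * g x₀ = f x₀ / g x₀) := by
  rw [quadratic_transform_eq (hf x₀) (hg x₀)]
  refine ⟨⟨fun h x y => (quadratic_transform_le (hf x) (hg x) y).trans (h x), fun h x => ?_⟩, rfl⟩
  rw [← quadratic_transform_eq (hf x) (hg x)]
  exact h x _
end

section
/- Let B, ω, Pₛ, σ² be positive real constants, and define the energy efficiency function η(p) = B·(log p − log σ²) / (ωp + Pₛ) for p > 0 (logarithm to any fixed base, e.g. natural log). Then there exists a unique p* > 0 such that η is strictly monotone increasing on the interval (0, p*] and strictly monotone decreasing on [p*, ∞); moreover p* > σ². In particular, η grows with the available transmit power when the power is small and eventually decreases (flattens and turns) once the transmit power exceeds the threshold p*. -/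
open Set

/-- The stationarity function `ω + Ps / p - ω (log p - log σ2)`, which carries the sign of the
derivative of the energy efficiency, is strictly decreasing in `p`. -/
theorem stationarity_strictAntiOn {ω Ps : ℝ} (σ2 : ℝ) (hω : 0 < ω) (hPs : 0 < Ps) :
    StrictAntiOn (fun p : ℝ => ω + Ps / p - ω * (Real.log p - Real.log σ2)) (Ioi 0) := by
  intro x hx y _ hxy
  have hx0 : 0 < x := hx
  have h1 : Ps / y < Ps / x := div_lt_div_of_pos_left hPs hx0 hxy
  have h2 := mul_lt_mul_of_pos_left (Real.log_lt_log hx0 hxy) hω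
  dsimp only
  linarith

theorem exists_stationary_point {ω Ps σ2 : ℝ} (hω : 0 < ω) (hPs : 0 < Ps) (hσ : 0 < σ2) :
    ∃ p, σ2 < p ∧ ω + Ps / p - ω * (Real.log p - Real.log σ2) = 0 := by
  have he : 0 < 1 + Ps / (ω * σ2) := by positivity
  set q := σ2 * Real.exp (1 + Ps / (ω * σ2)) with hq
  have hσq : σ2 < q := lt_mul_of_one_lt_right hσ (Real.one_lt_exp_iff.mpr he)
  have hlog : Real.log q = Real.log σ2 + (1 + Ps / (ω * σ2)) := by
    rw [hq, Real.log_mul hσ.ne' (Real.exp_ne_zero _), Real.log_exp]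
  have hcont : ContinuousOn (fun p : ℝ => ω + Ps / p - ω * (Real.log p - Real.log σ2))
      (Icc σ2 q) := by
    have hne : ∀ p ∈ Icc σ2 q, p ≠ 0 := fun p hp => (hσ.trans_le hp.1).ne'
    fun_prop (disch := assumption)
  have hq_neg : ω + Ps / q - ω * (Real.log q - Real.log σ2) < 0 := by
    have h1 : Ps / q < Ps / σ2 := div_lt_div_of_pos_left hPs hσ hσq
    have h2 : ω * (1 + Ps / (ω * σ2)) = ω + Ps / σ2 := by field_simp
    rw [hlog, add_sub_cancel_left, h2]
    linarith
  have hσ_pos : 0 < ω + Ps / σ2 - ω * (Real.log σ2 - Real.log σ2) := by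
    rw [sub_self, mul_zero, sub_zero]
    positivity
  obtain ⟨p, hp, hp0⟩ := intermediate_value_Ioo' hσq.le hcont ⟨hq_neg, hσ_pos⟩
  exact ⟨p, hp.1, hp0⟩

theorem hasDerivAt_energyEfficiency (B : ℝ) {ω Ps : ℝ} (σ2 : ℝ) {p : ℝ} (hω : 0 < ω)
    (hPs : 0 < Ps) (hp : 0 < p) :
    HasDerivAt (fun p : ℝ => B * (Real.log p - Real.log σ2) / (ω * p + Ps))
      (B * (ω + Ps / p - ω * (Real.log p - Real.log σ2)) / (ω * p + Ps) ^ 2) p := by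
  have hden : ω * p + Ps ≠ 0 := by positivity
  refine ((((Real.hasDerivAt_log hp.ne').sub_const (Real.log σ2)).const_mul B).fun_div
    (((hasDerivAt_id' p).const_mul ω).add_const Ps) hden).congr_deriv ?_
  field_simp

/-- Proposition 1: the high-SNR energy efficiency
`η(p) = B·(log p − log σ²)/(ωp + Pₛ)` is unimodal in the total transmit power:
there is a unique `p* > 0` such that `η` strictly increases on `(0, p*]` and
strictly decreases on `[p*, ∞)`, and moreover `p* > σ²`. -/
theorem ee_vs_transmit_power (B ω Ps σ2 : ℝ)
    (hB : 0 < B) (hω : 0 < ω) (hPs : 0 < Ps) (hσ : 0 < σ2) :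
    ∃! pstar : ℝ, 0 < pstar ∧
      StrictMonoOn (fun p : ℝ => B * (Real.log p - Real.log σ2) / (ω * p + Ps))
        (Set.Ioc 0 pstar) ∧
      StrictAntiOn (fun p : ℝ => B * (Real.log p - Real.log σ2) / (ω * p + Ps))
        (Set.Ici pstar) ∧
      σ2 < pstar := by
  have hanti := stationarity_strictAntiOn σ2 hω hPs
  have hderiv {p : ℝ} (hp : 0 < p) := hasDerivAt_energyEfficiency B σ2 hω hPs hp
  obtain ⟨pstar, hσp, hzero⟩ := exists_stationary_point hω hPs hσ
  have hpos : 0 < pstar := hσ.trans hσp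
  refine existsUnique_of_exists_of_unique ⟨pstar, hpos, ?_, ?_, hσp⟩ ?_
  · refine strictMonoOn_of_deriv_pos (convex_Ioc 0 pstar)
      (fun p hp => (hderiv hp.1).continuousAt.continuousWithinAt) fun p hp => ?_
    rw [interior_Ioc] at hp
    have hp0 : 0 < p := hp.1
    have hg := hzero.symm.trans_lt (hanti hp0 hpos hp.2)
    rw [(hderiv hp0).deriv]
    exact div_pos (mul_pos hB hg) (by positivity)
  · refine strictAntiOn_of_deriv_neg (convex_Ici pstar)
      (fun p hp => (hderiv (hpos.trans_le hp)).continuousAt.continuousWithinAt) fun p hp => ?_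
    rw [interior_Ici] at hp
    have hp0 : 0 < p := hpos.trans hp
    have hg := (hanti hpos hp0 hp).trans_eq hzero
    rw [(hderiv hp0).deriv]
    exact div_neg_of_neg_of_pos (mul_neg_of_pos_of_neg hB hg) (by positivity)
  · rintro p q ⟨hp, hp_mono, hp_anti, -⟩ ⟨hq, hq_mono, hq_anti, -⟩
    rcases lt_trichotomy p q with h | h | h
    · exact absurd (hq_mono ⟨hp, h.le⟩ ⟨hq, le_rfl⟩ h)
        (hp_anti self_mem_Ici h.le h).not_gt
    · exact h
    · exact absurd (hp_mono ⟨hq, h.le⟩ ⟨hp, le_rfl⟩ h)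
        (hq_anti self_mem_Ici h.le h).not_gt
end

section
/- Let c₁, c₂, c₃ be positive real constants and c₄, c₅ nonnegative real constants with c₁ < c₂. Define η(M) = (c₁·log M + c₂) / (c₃·M² + c₄·M + c₅) for M > 0 (natural logarithm). If M ≥ 1 and c₁·c₅ ≤ c₂·c₃·M², then the derivative of η at M is strictly negative: η'(M) < 0. -/
/-- Proposition 2 (energy efficiency versus number of RISs): in the
large-deployment high-SNR regime (`c₁ < c₂`, `c₁c₅ ≤ c₂c₃M²`, `M ≥ 1`)
the derivative of `η(M) = (c₁ log M + c₂)/(c₃M² + c₄M + c₅)` is negative. -/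
theorem ee_decreasing_in_num_RIS (c1 c2 c3 c4 c5 M : ℝ)
    (h1 : 0 < c1) (h2 : 0 < c2) (h3 : 0 < c3) (h4 : 0 ≤ c4) (h5 : 0 ≤ c5)
    (h12 : c1 < c2) (hM : 1 ≤ M) (hc : c1 * c5 ≤ c2 * c3 * M ^ 2) :
    deriv (fun M : ℝ => (c1 * Real.log M + c2) / (c3 * M ^ 2 + c4 * M + c5)) M
      < 0 := by
  have hM0 : 0 < M := by linarith
  have hden : 0 < c3 * M ^ 2 + c4 * M + c5 := by positivity
  have hnum : HasDerivAt (fun x : ℝ => c1 * Real.log x + c2) (c1 * M⁻¹) M :=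
    ((Real.hasDerivAt_log hM0.ne').const_mul c1).add_const c2
  have hden' : HasDerivAt (fun x : ℝ => c3 * x ^ 2 + c4 * x + c5) (c3 * (2 * M) + c4) M := by
    simpa using ((((hasDerivAt_id M).pow 2).const_mul c3).add
      ((hasDerivAt_id M).const_mul c4)).add_const c5
  rw [(hnum.fun_div hden' hden.ne').deriv]
  refine div_neg_of_neg_of_pos ?_ (by positivity)
  have hlog : 0 ≤ c1 * Real.log M * (c3 * (2 * M) + c4) :=
    mul_nonneg (mul_nonneg h1.le (Real.log_nonneg hM)) (by positivity)
  have hquot : c1 * c5 * M⁻¹ ≤ c2 * c3 * M := by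
    rw [← div_eq_mul_inv, div_le_iff₀ hM0]
    linarith
  have hexpand : c1 * M⁻¹ * (c3 * M ^ 2 + c4 * M + c5)
      = c1 * c3 * M + c1 * c4 + c1 * c5 * M⁻¹ := by
    field_simp
  have hlead : c1 * (c3 * M) < c2 * (c3 * M) := by gcongr
  have hlin : c1 * c4 ≤ c2 * c4 := by gcongr
  rw [hexpand]
  linarith
end

section
/- Let c₁, c₂, c₃ be positive real constants and c₄, c₅ nonnegative real constants satisfying c₁ < c₂ and c₁·c₅ ≤ c₂·c₃. Then the function η(M) = (c₁·log M + c₂)/(c₃·M² + c₄·M + c₅) (natural logarithm) is strictly decreasing on the interval [1, ∞): for all 1 ≤ M₁ < M₂ one has η(M₂) < η(M₁). -/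
/-- Corollary of Proposition 2: with `c₁ < c₂` and `c₁c₅ ≤ c₂c₃`, the energy
efficiency `η(M) = (c₁ log M + c₂)/(c₃M² + c₄M + c₅)` is strictly decreasing
on `[1, ∞)`. -/
theorem ee_strict_anti_in_num_RIS (c1 c2 c3 c4 c5 : ℝ)
    (h1 : 0 < c1) (h2 : 0 < c2) (h3 : 0 < c3) (h4 : 0 ≤ c4) (h5 : 0 ≤ c5)
    (h12 : c1 < c2) (hc : c1 * c5 ≤ c2 * c3) :
    StrictAntiOn
      (fun M : ℝ => (c1 * Real.log M + c2) / (c3 * M ^ 2 + c4 * M + c5))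
      (Set.Ici 1) := by
  intro a ha b hb hab
  simp only [Set.mem_Ici] at ha hb
  have ha0 : 0 < a := by linarith
  have hb0 : 0 < b := by linarith
  have hDa : 0 < c3 * a ^ 2 + c4 * a + c5 := by positivity
  have hDb : 0 < c3 * b ^ 2 + c4 * b + c5 := by positivity
  have hL : 0 ≤ Real.log a := Real.log_nonneg ha
  have hlog : a * (Real.log b - Real.log a) < b - a := by
    have h := Real.log_lt_sub_one_of_pos (div_pos hb0 ha0)
      (by rw [Ne, div_eq_one_iff_eq ha0.ne']; exact hab.ne')
    rw [Real.log_div hb0.ne' ha0.ne'] at h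
    calc a * (Real.log b - Real.log a) < a * (b / a - 1) := by gcongr
      _ = b - a := by field_simp
  have hcoef : c1 * (c3 * a ^ 2 + c4 * a + c5) ≤ c2 * (a * (c3 * (a + b) + c4)) := by
    have hab1 : 1 ≤ a * b := one_le_mul_of_one_le_of_one_le ha hb
    have hquad : c1 * (c3 * a ^ 2 + c4 * a) ≤ c2 * (c3 * a ^ 2 + c4 * a) := by gcongr
    have hconst : c2 * c3 * 1 ≤ c2 * c3 * (a * b) := by gcongr
    linarith
  have hslope : c2 * (a * (c3 * (a + b) + c4)) ≤
      (c1 * Real.log a + c2) * (a * (c3 * (a + b) + c4)) := by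
    gcongr
    exact le_add_of_nonneg_left (by positivity)
  have hincr := mul_le_mul_of_nonneg_right (hcoef.trans hslope) (sub_pos.2 hab).le
  have hnum := mul_lt_mul_of_pos_left hlog (mul_pos h1 hDa)
  simp only
  rw [div_lt_div_iff₀ hDb hDa]
  refine lt_of_mul_lt_mul_left ?_ ha0.le
  linarith
end

section
/- Let α, γ, δ be positive real constants and define g(L) = α·(γ + δ·L)/(1 + α·L) − δ·log(1 + α·L) for L ≥ 0 (natural logarithm). Then: (a) g is strictly decreasing on [0, ∞); (b) g(0) = α·γ > 0; (c) g(L) → −∞ as L → ∞. Consequently g has a unique zero L* ∈ (0, ∞), with g(L) > 0 for 0 ≤ L < L* and g(L) < 0 for L > L*. -/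
open Set Filter

/-- A continuous strictly decreasing function on `[a, ∞)` that is positive at `a` and tends to
`-∞` has a unique zero in `(a, ∞)`, at which it changes sign from positive to negative. -/
theorem StrictAntiOn.existsUnique_sign_change {f : ℝ → ℝ} {a : ℝ}
    (hf : StrictAntiOn f (Ici a)) (hc : ContinuousOn f (Ici a)) (ha : 0 < f a)
    (hlim : Tendsto f atTop atBot) :
    ∃! z : ℝ, a < z ∧ f z = 0 ∧ (∀ x, a ≤ x → x < z → 0 < f x) ∧ ∀ x, z < x → f x < 0 := by
  obtain ⟨b, hfb, hab⟩ := ((hlim.eventually_le_atBot 0).and (eventually_ge_atTop a)).exists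
  obtain ⟨z, hz, hfz⟩ := intermediate_value_Icc' hab (hc.mono Icc_subset_Ici_self) ⟨hfb, ha.le⟩
  have haz : a < z := hz.1.lt_of_ne (by rintro rfl; exact ha.ne' hfz)
  refine ⟨z, ⟨haz, hfz, fun x hax hxz => ?_, fun x hzx => ?_⟩, ?_⟩
  · exact hfz ▸ hf hax hz.1 hxz
  · exact hfz ▸ hf hz.1 (hz.1.trans hzx.le) hzx
  · rintro y ⟨hay, hfy, -⟩
    exact hf.injOn hay.le hz.1 (hfy.trans hfz.symm)

theorem strictAntiOn_div_sub_log {α γ δ : ℝ} (hα : 0 < α) (hγ : 0 < γ) (hδ : 0 < δ) :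
    StrictAntiOn
      (fun L : ℝ => α * (γ + δ * L) / (1 + α * L) - δ * Real.log (1 + α * L)) (Ici 0) := by
  intro x hx y hy hxy
  rw [mem_Ici] at hx hy
  have hu : 0 < 1 + α * x := by positivity
  have hv : 0 < 1 + α * y := by positivity
  have hlog := Real.one_sub_inv_le_log_of_pos (div_pos hv hu)
  rw [Real.log_div hv.ne' hu.ne', inv_div] at hlog
  have hdiff : α * (γ + δ * x) / (1 + α * x) - α * (γ + δ * y) / (1 + α * y)
      + δ * (1 - (1 + α * x) / (1 + α * y))
      = α ^ 2 * (y - x) * (γ + δ * x) / ((1 + α * x) * (1 + α * y)) := by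
    field_simp
    ring
  have hpos : 0 < α ^ 2 * (y - x) * (γ + δ * x) / ((1 + α * x) * (1 + α * y)) := by
    have := sub_pos.2 hxy
    positivity
  have := mul_le_mul_of_nonneg_left hlog hδ.le
  dsimp only
  linarith

theorem tendsto_div_sub_log_atBot {α γ δ : ℝ} (hα : 0 < α) (hγ : 0 < γ) (hδ : 0 < δ) :
    Tendsto (fun L : ℝ => α * (γ + δ * L) / (1 + α * L) - δ * Real.log (1 + α * L))
      atTop atBot := by
  have hlog : Tendsto (fun L : ℝ => δ * Real.log (1 + α * L)) atTop atTop :=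
    (Real.tendsto_log_atTop.comp
      (tendsto_atTop_add_const_left _ 1 (tendsto_id.const_mul_atTop hα))).const_mul_atTop hδ
  refine tendsto_atBot_mono' _ ?_
    (tendsto_atBot_add_const_left _ (α * γ + δ) (tendsto_neg_atTop_atBot.comp hlog))
  filter_upwards [eventually_ge_atTop 0] with L hL
  have hbound : α * (γ + δ * L) / (1 + α * L) ≤ α * γ + δ := by
    rw [div_le_iff₀ (by positivity)]
    have : 0 ≤ α * γ * (α * L) := by positivity
    linarith
  simp only [Function.comp_apply]
  linarith

theorem continuousOn_div_sub_log {α : ℝ} (hα : 0 < α) (γ δ : ℝ) :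
    ContinuousOn
      (fun L : ℝ => α * (γ + δ * L) / (1 + α * L) - δ * Real.log (1 + α * L)) (Ici 0) := by
  have hne : ∀ L ∈ Ici (0 : ℝ), 1 + α * L ≠ 0 := fun L hL => by
    rw [mem_Ici] at hL
    positivity
  exact (ContinuousOn.div (by fun_prop) (by fun_prop) hne).sub
    (continuousOn_const.mul (ContinuousOn.log (by fun_prop) hne))


/-- Supporting lemma for Proposition 3: properties of the auxiliary function
`g(L) = α(γ + δL)/(1 + αL) − δ·log(1 + αL)`. -/
theorem aux_function_g (α γ δ : ℝ) (hα : 0 < α) (hγ : 0 < γ) (hδ : 0 < δ) :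
    StrictAntiOn
      (fun L : ℝ => α * (γ + δ * L) / (1 + α * L) - δ * Real.log (1 + α * L))
      (Set.Ici 0) ∧
    (α * (γ + δ * 0) / (1 + α * 0) - δ * Real.log (1 + α * 0) = α * γ ∧
      0 < α * γ) ∧
    Filter.Tendsto
      (fun L : ℝ => α * (γ + δ * L) / (1 + α * L) - δ * Real.log (1 + α * L))
      Filter.atTop Filter.atBot ∧
    (∃! Lstar : ℝ, 0 < Lstar ∧
      α * (γ + δ * Lstar) / (1 + α * Lstar) - δ * Real.log (1 + α * Lstar) = 0 ∧
      (∀ L : ℝ, 0 ≤ L → L < Lstar →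
        0 < α * (γ + δ * L) / (1 + α * L) - δ * Real.log (1 + α * L)) ∧
      (∀ L : ℝ, Lstar < L →
        α * (γ + δ * L) / (1 + α * L) - δ * Real.log (1 + α * L) < 0)) := by
  have hanti := strictAntiOn_div_sub_log hα hγ hδ
  have hlim := tendsto_div_sub_log_atBot hα hγ hδ
  have hzero : α * (γ + δ * 0) / (1 + α * 0) - δ * Real.log (1 + α * 0) = α * γ := by simp
  have hpos : 0 < α * γ := mul_pos hα hγ
  exact ⟨hanti, ⟨hzero, hpos⟩, hlim,
    hanti.existsUnique_sign_change (continuousOn_div_sub_log hα γ δ) (hpos.trans_eq hzero.symm)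
      hlim⟩
end
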